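/- For every formula φ of the logic K^#, there exists a GNN A such that for every pointed graph (G,u), (G,u) satisfies φ if and only if A accepts (G,u); that is, ⟦φ⟧ = ⟦A⟧. -/

import Mathlib

/-- A labeled directed graph: finite vertex set, directed edges, and a
labeling of each vertex by a valuation over atomic propositions (ℕ). -/
structure PGraph where
  V : Type
  fintV : Fintype V
  decV : DecidableEq V
  E : V → V → Bool
  label : V → ℕ → Bool

attribute [instance] PGraph.fintV PGraph.decV

mutual
/-- Formulas of the logic K^#. -/
inductive KForm : Type where
  | atom : ℕ → KForm
  | neg : KForm → KForm
  | or : KForm → KForm → KForm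
  | geq : KExpr → KForm          -- ξ ≥ 0
/-- Arithmetic expressions of the logic K^#. -/
inductive KExpr : Type where
  | const : ℤ → KExpr
  | one : KForm → KExpr          -- 1_φ
  | count : KForm → KExpr        -- #φ
  | add : KExpr → KExpr → KExpr
  | mul : ℤ → KExpr → KExpr      -- c × ξ
end

mutual
/-- Truth of a K^# formula at a pointed graph. -/
def KForm.eval (G : PGraph) : G.V → KForm → Bool
  | u, .atom p => G.label u p
  | u, .neg φ => !(KForm.eval G u φ)
  | u, .or φ ψ => KForm.eval G u φ || KForm.eval G u ψ
  | u, .geq ξ => decide (0 ≤ KExpr.eval G u ξ)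
/-- Value of a K^# arithmetic expression at a pointed graph. -/
def KExpr.eval (G : PGraph) : G.V → KExpr → ℤ
  | _, .const c => c
  | u, .one φ => if KForm.eval G u φ then 1 else 0
  | u, .count φ =>
      ((Finset.univ.filter (fun v => G.E u v && KForm.eval G v φ = true)).card : ℤ)
  | u, .add ξ ξ' => KExpr.eval G u ξ + KExpr.eval G u ξ'
  | u, .mul c ξ => c * KExpr.eval G u ξ
end

def KForm.satisfiable (φ : KForm) : Prop := ∃ (G : PGraph) (u : G.V), φ.eval G u = true

def KForm.valid (φ : KForm) : Prop := ∀ (G : PGraph) (u : G.V), φ.eval G u = true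

/-- Truncated ReLU. -/
noncomputable def trunc (x : ℝ) : ℝ := max 0 (min 1 x)

/-- A GNN: `L` layers; layer `t` (for `0 ≤ t < L`) has integer matrices
`C t`, `A t` and integer bias `b t`, mapping states of dimension `dim t` to
states of dimension `dim (t+1)`; `a` gives the integer coefficients of the
final linear classification function. The initial dimension `dim 0` is the
number of atomic propositions used. -/
structure GNN where
  L : ℕ
  dim : ℕ → ℕ
  C : (t : ℕ) → Matrix (Fin (dim t)) (Fin (dim (t + 1))) ℤ
  A : (t : ℕ) → Matrix (Fin (dim t)) (Fin (dim (t + 1))) ℤ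
  b : (t : ℕ) → Fin (dim (t + 1)) → ℤ
  a : Fin (dim L) → ℤ

/-- The state of a GNN on a graph after `t` layers. -/
noncomputable def GNN.state (N : GNN) (G : PGraph) : (t : ℕ) → G.V → Fin (N.dim t) → ℝ
  | 0, u, i => if G.label u i then 1 else 0
  | t + 1, u, j => trunc (
      (∑ i, N.state G t u i * (N.C t i j : ℝ)) +
      (∑ i, (∑ v ∈ Finset.univ.filter (fun v => G.E u v = true), N.state G t v i)
            * (N.A t i j : ℝ)) +
      (N.b t j : ℝ))

/-- The GNN accepts a pointed graph iff `cls(x_L(u)) = 1`, i.e. `Σ a_i x_i ≥ 1`. -/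
noncomputable def GNN.accepts (N : GNN) (G : PGraph) (u : G.V) : Prop :=
  1 ≤ ∑ i, (N.a i : ℝ) * N.state G N.L u i

mutual
/-- Modal depth of a K^# formula. -/
def KForm.md : KForm → ℕ
  | .atom _ => 0
  | .neg φ => φ.md
  | .or φ ψ => max φ.md ψ.md
  | .geq ξ => ξ.md
/-- Modal depth of a K^# expression. -/
def KExpr.md : KExpr → ℕ
  | .const _ => 0
  | .one φ => φ.md
  | .count φ => φ.md + 1
  | .add ξ ξ' => max ξ.md ξ'.md
  | .mul _ ξ => ξ.md
end

mutual
/-- Size (number of syntax-tree nodes) of a K^# formula. -/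
def KForm.size : KForm → ℕ
  | .atom _ => 1
  | .neg φ => φ.size + 1
  | .or φ ψ => φ.size + ψ.size + 1
  | .geq ξ => ξ.size + 1
/-- Size (number of syntax-tree nodes) of a K^# expression. -/
def KExpr.size : KExpr → ℕ
  | .const _ => 1
  | .one φ => φ.size + 1
  | .count φ => φ.size + 1
  | .add ξ ξ' => ξ.size + ξ'.size + 1
  | .mul _ ξ => ξ.size + 2
end

mutual
/-- Atomic propositions occurring in a K^# formula. -/
def KForm.atoms : KForm → Finset ℕ
  | .atom p => {p}
  | .neg φ => φ.atoms
  | .or φ ψ => φ.atoms ∪ ψ.atoms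
  | .geq ξ => ξ.atoms
/-- Atomic propositions occurring in a K^# expression. -/
def KExpr.atoms : KExpr → Finset ℕ
  | .const _ => ∅
  | .one φ => φ.atoms
  | .count φ => φ.atoms
  | .add ξ ξ' => ξ.atoms ∪ ξ'.atoms
  | .mul _ ξ => ξ.atoms
end

/-- Conjunction, defined from ¬ and ∨. -/
def KForm.andF (φ ψ : KForm) : KForm := .neg (.or (.neg φ) (.neg ψ))

/-- Implication, defined from ¬ and ∨. -/
def KForm.impF (φ ψ : KForm) : KForm := .or (.neg φ) ψ

/-- Bi-implication, defined from ¬ and ∨. -/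
def KForm.iffF (φ ψ : KForm) : KForm := KForm.andF (φ.impF ψ) (ψ.impF φ)

/-- The modality □φ, abbreviating `0 − #(¬φ) ≥ 0`. -/
def KForm.box (φ : KForm) : KForm :=
  .geq (.add (.const 0) (.mul (-1) (.count (.neg φ))))

/-- `i`-fold iteration □^i of □. -/
def KForm.boxIter : ℕ → KForm → KForm
  | 0, φ => φ
  | i + 1, φ => KForm.box (KForm.boxIter i φ)

/-- The modality `□^{≤m} φ := ⋀_{0 ≤ i ≤ m} □^i φ`. -/
def KForm.boxUpTo : ℕ → KForm → KForm
  | 0, φ => φ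
  | m + 1, φ => KForm.andF (KForm.boxUpTo m φ) (KForm.boxIter (m + 1) φ)

/-- `#ψ = k`, abbreviating `(#ψ − k ≥ 0) ∧ (k − #ψ ≥ 0)`. -/
def KForm.countEq (ψ : KForm) (k : ℤ) : KForm :=
  KForm.andF (.geq (.add (.count ψ) (.const (-k))))
             (.geq (.add (.const k) (.mul (-1) (.count ψ))))

mutual
/-- Subformulas of a K^# formula, including itself. -/
def KForm.sub : KForm → List KForm
  | .atom p => [.atom p]
  | .neg φ => .neg φ :: φ.sub
  | .or φ ψ => .or φ ψ :: (φ.sub ++ ψ.sub)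
  | .geq ξ => .geq ξ :: ξ.sub
/-- Subformulas occurring in a K^# expression. -/
def KExpr.sub : KExpr → List KForm
  | .const _ => []
  | .one φ => φ.sub
  | .count φ => φ.sub
  | .add ξ ξ' => ξ.sub ++ ξ'.sub
  | .mul _ ξ => ξ.sub
end

theorem KForm.self_mem_sub (φ : KForm) : φ ∈ φ.sub := by
  cases φ <;> simp [KForm.sub]

mutual
theorem KForm.sub_subset : ∀ φ ψ : KForm, ψ ∈ φ.sub → ψ.sub ⊆ φ.sub
  | .atom p, ψ, h => by
      simp only [KForm.sub, List.mem_singleton] at h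
      subst h
      exact List.Subset.refl _
  | .neg φ, ψ, h => by
      have ih := KForm.sub_subset φ ψ
      rw [KForm.sub, List.mem_cons] at h
      rcases h with rfl | h
      · exact List.Subset.refl _
      · exact List.subset_cons_of_subset _ (ih h)
  | .or φ χ, ψ, h => by
      have ih := KForm.sub_subset φ ψ
      have ih' := KForm.sub_subset χ ψ
      rw [KForm.sub, List.mem_cons, List.mem_append] at h
      rcases h with rfl | h | h
      · exact List.Subset.refl _
      · exact List.subset_cons_of_subset _ (List.subset_append_of_subset_left _ (ih h))
      · exact List.subset_cons_of_subset _ (List.subset_append_of_subset_right _ (ih' h))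
  | .geq ξ, ψ, h => by
      have ih := KExpr.sub_subset ξ ψ
      rw [KForm.sub, List.mem_cons] at h
      rcases h with rfl | h
      · exact List.Subset.refl _
      · exact List.subset_cons_of_subset _ (ih h)
theorem KExpr.sub_subset : ∀ (ξ : KExpr) (ψ : KForm), ψ ∈ ξ.sub → ψ.sub ⊆ ξ.sub
  | .const _, ψ, h => by simp [KExpr.sub] at h
  | .one φ, ψ, h => KForm.sub_subset φ ψ h
  | .count φ, ψ, h => KForm.sub_subset φ ψ h
  | .add ξ ξ', ψ, h => by
      have ih := KExpr.sub_subset ξ ψ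
      have ih' := KExpr.sub_subset ξ' ψ
      rw [KExpr.sub, List.mem_append] at h
      rcases h with h | h
      · exact List.subset_append_of_subset_left _ (ih h)
      · exact List.subset_append_of_subset_right _ (ih' h)
  | .mul _ ξ, ψ, h => KExpr.sub_subset ξ ψ h
end

/-- Every finite list of formulas mentions boundedly many atoms at its top level. -/
theorem KForm.exists_atom_bound (l : List KForm) : ∃ m : ℕ, ∀ p, KForm.atom p ∈ l → p < m := by
  induction l with
  | nil => exact ⟨0, by simp⟩
  | cons χ l ih =>
    obtain ⟨m, hm⟩ := ih
    cases χ with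
    | atom q =>
      refine ⟨max m (q + 1), fun p hp => ?_⟩
      simp only [List.mem_cons, KForm.atom.injEq] at hp
      rcases hp with rfl | hp
      · omega
      · have := hm p hp
        omega
    | _ => exact ⟨m, fun p hp => hm p (by simpa using hp)⟩

theorem trunc_indicator {x : ℝ} {q : Bool} (h1 : q = true → 1 ≤ x) (h0 : q = false → x ≤ 0) :
    trunc x = if q then 1 else 0 := by
  unfold trunc
  cases q
  · simp [min_le_of_right_le (h0 rfl)]
  · simp [h1 rfl]

/-- The truth value of a formula as a real number. -/
def KForm.indicator (φ : KForm) (G : PGraph) (u : G.V) : ℝ :=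
  if φ.eval G u then 1 else 0

/-- The argument of the activation function at one coordinate of a GNN layer. -/
def preactivation {n : ℕ} (c a : Fin n → ℤ) (b : ℤ) {G : PGraph} (x : G.V → Fin n → ℝ)
    (u : G.V) : ℝ :=
  (∑ i, x u i * (c i : ℝ)) +
    (∑ i, (∑ v ∈ Finset.univ.filter (fun v => G.E u v = true), x v i) * (a i : ℝ)) + (b : ℝ)

section Preactivation

variable {n : ℕ} {G : PGraph}

theorem preactivation_zero (b : ℤ) (x : G.V → Fin n → ℝ) (u : G.V) :
    preactivation 0 0 b x u = b := by
  simp [preactivation]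

theorem preactivation_add (c a c' a' : Fin n → ℤ) (b b' : ℤ) (x : G.V → Fin n → ℝ) (u : G.V) :
    preactivation (c + c') (a + a') (b + b') x u =
      preactivation c a b x u + preactivation c' a' b' x u := by
  simp only [preactivation, Pi.add_apply, Int.cast_add, mul_add, Finset.sum_add_distrib]
  ring

theorem preactivation_smul (k : ℤ) (c a : Fin n → ℤ) (b : ℤ) (x : G.V → Fin n → ℝ) (u : G.V) :
    preactivation (k • c) (k • a) (k * b) x u = k * preactivation c a b x u := by
  simp only [preactivation, Pi.smul_apply, smul_eq_mul, Int.cast_mul, mul_add, Finset.mul_sum,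
    mul_left_comm]

theorem preactivation_single_self (i : Fin n) (x : G.V → Fin n → ℝ) (u : G.V) :
    preactivation (Pi.single i 1) 0 0 x u = x u i := by
  simp [preactivation, Pi.single_apply]

theorem preactivation_single_neighbors (i : Fin n) (x : G.V → Fin n → ℝ) (u : G.V) :
    preactivation 0 (Pi.single i 1) 0 x u =
      ∑ v ∈ Finset.univ.filter (fun v => G.E u v = true), x v i := by
  simp [preactivation, Pi.single_apply]

end Preactivation

/-- The state `x` holds the truth values of the formulas `f i` for all coordinates `i` in `B`
and all those where `f i` has size at most `k`. -/
def CorrectUpTo {n : ℕ} (f : Fin n → KForm) (B : Set (Fin n)) (k : ℕ) {G : PGraph}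
    (x : G.V → Fin n → ℝ) : Prop :=
  ∀ v i, i ∈ B ∨ (f i).size ≤ k → x v i = (f i).indicator G v

/-- Expressions are affine in the truth values of their subformulas. -/
theorem KExpr.exists_preactivation_eq {n : ℕ} (f : Fin n → KForm) (B : Set (Fin n)) :
    ∀ ξ : KExpr, (∀ χ ∈ ξ.sub, χ ∈ Set.range f) →
      ∃ (c a : Fin n → ℤ) (b : ℤ), ∀ (k : ℕ) (G : PGraph) (x : G.V → Fin n → ℝ),
        CorrectUpTo f B k x → ξ.size ≤ k → ∀ u, preactivation c a b x u = (ξ.eval G u : ℝ)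
  | .const b, _ => ⟨0, 0, b, fun k G x _ _ u => by simp [preactivation_zero, KExpr.eval]⟩
  | .one φ, h => by
      obtain ⟨i, rfl⟩ := h φ φ.self_mem_sub
      refine ⟨Pi.single i 1, 0, 0, fun k G x hx hk u => ?_⟩
      rw [KExpr.size] at hk
      rw [preactivation_single_self, hx u i (Or.inr (by omega))]
      simp [KForm.indicator, KExpr.eval]
  | .count φ, h => by
      obtain ⟨i, rfl⟩ := h φ φ.self_mem_sub
      refine ⟨0, Pi.single i 1, 0, fun k G x hx hk u => ?_⟩
      rw [KExpr.size] at hk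
      rw [preactivation_single_neighbors]
      simp only [fun v => hx v i (Or.inr (by omega)), KForm.indicator, Finset.sum_boole,
        Finset.filter_filter]
      simp [KExpr.eval]
  | .add ξ ξ', h => by
      obtain ⟨c, a, b, H⟩ := KExpr.exists_preactivation_eq f B ξ
        fun χ hχ => h χ (List.mem_append_left _ hχ)
      obtain ⟨c', a', b', H'⟩ := KExpr.exists_preactivation_eq f B ξ'
        fun χ hχ => h χ (List.mem_append_right _ hχ)
      refine ⟨c + c', a + a', b + b', fun k G x hx hk u => ?_⟩
      rw [KExpr.size] at hk
      rw [preactivation_add, H k G x hx (by omega), H' k G x hx (by omega)]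
      simp [KExpr.eval]
  | .mul d ξ, h => by
      obtain ⟨c, a, b, H⟩ := KExpr.exists_preactivation_eq f B ξ h
      refine ⟨d • c, d • a, d * b, fun k G x hx hk u => ?_⟩
      rw [KExpr.size] at hk
      rw [preactivation_smul, H k G x hx (by omega)]
      simp [KExpr.eval]

/-- The truth value of a formula is computed by one neuron from those of its subformulas. -/
theorem KForm.exists_trunc_preactivation_eq {n : ℕ} (f : Fin n → KForm) (B : Set (Fin n))
    (hB : ∀ p, KForm.atom p ∈ Set.range f → ∃ i ∈ B, f i = .atom p) (ψ : KForm)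
    (h : ∀ χ ∈ ψ.sub, χ ∈ Set.range f) :
    ∃ (c a : Fin n → ℤ) (b : ℤ), ∀ (k : ℕ) (G : PGraph) (x : G.V → Fin n → ℝ),
      CorrectUpTo f B k x → ψ.size ≤ k + 1 →
        ∀ u, trunc (preactivation c a b x u) = ψ.indicator G u := by
  cases ψ with
  | atom p =>
    obtain ⟨i, hi, hf⟩ := hB p (h _ (KForm.self_mem_sub _))
    refine ⟨Pi.single i 1, 0, 0, fun k G x hx _ u => ?_⟩
    rw [preactivation_single_self, hx u i (Or.inl hi), hf, KForm.indicator]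
    exact trunc_indicator (fun h => by simp [h]) (fun h => by simp [h])
  | neg φ =>
    obtain ⟨i, rfl⟩ := h φ (List.mem_cons_of_mem _ φ.self_mem_sub)
    refine ⟨(-1 : ℤ) • Pi.single i 1 + 0, (-1 : ℤ) • 0 + 0, -1 * 0 + 1,
      fun k G x hx hk u => ?_⟩
    rw [KForm.size] at hk
    rw [preactivation_add, preactivation_smul, preactivation_single_self, preactivation_zero,
      hx u i (Or.inr (by omega))]
    apply trunc_indicator <;> cases hq : (f i).eval G u <;> simp [KForm.indicator, KForm.eval, hq]
  | or φ χ =>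
    obtain ⟨i, rfl⟩ := h φ (List.mem_cons_of_mem _ (List.mem_append_left _ φ.self_mem_sub))
    obtain ⟨j, rfl⟩ := h χ (List.mem_cons_of_mem _ (List.mem_append_right _ χ.self_mem_sub))
    refine ⟨Pi.single i 1 + Pi.single j 1, 0 + 0, 0 + 0, fun k G x hx hk u => ?_⟩
    rw [KForm.size] at hk
    rw [preactivation_add, preactivation_single_self, preactivation_single_self,
      hx u i (Or.inr (by omega)), hx u j (Or.inr (by omega))]
    apply trunc_indicator <;> cases hq : (f i).eval G u <;> cases hr : (f j).eval G u <;>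
      simp [KForm.indicator, KForm.eval, hq, hr]
  | geq ξ =>
    obtain ⟨c, a, b, H⟩ := KExpr.exists_preactivation_eq f B ξ
      fun χ hχ => h χ (List.mem_cons_of_mem _ hχ)
    refine ⟨c + 0, a + 0, b + 1, fun k G x hx hk u => ?_⟩
    rw [KForm.size] at hk
    rw [preactivation_add, H k G x hx (by omega), preactivation_zero, KForm.indicator]
    apply trunc_indicator
    · intro hq
      simp only [KForm.eval, decide_eq_true_eq] at hq
      have : (0 : ℝ) ≤ ξ.eval G u := by exact_mod_cast hq
      push_cast
      linarith
    · intro hq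
      simp only [KForm.eval, decide_eq_false_iff_not, not_le] at hq
      have : ξ.eval G u + 1 ≤ 0 := by omega
      exact_mod_cast this

/-- A subformula-closed finite enumeration starting with the atoms. -/
theorem KForm.exists_enumeration (φ : KForm) :
    ∃ (n m : ℕ) (f : Fin n → KForm), φ ∈ Set.range f ∧
      (∀ i, ∀ χ ∈ (f i).sub, χ ∈ Set.range f) ∧ (∀ i : Fin n, i < m → f i = .atom i) ∧
      ∀ p, KForm.atom p ∈ Set.range f → ∃ i : Fin n, i < m ∧ f i = .atom p := by
  obtain ⟨m, hm⟩ := KForm.exists_atom_bound φ.sub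
  have hr : ∀ χ ∈ φ.sub,
      χ ∈ Set.range (Fin.append (fun i : Fin m => KForm.atom i) φ.sub.get) := by
    intro χ hχ
    obtain ⟨j, rfl⟩ := List.mem_iff_get.1 hχ
    exact ⟨Fin.natAdd m j, by simp⟩
  refine ⟨m + φ.sub.length, m, Fin.append (fun i : Fin m => KForm.atom i) φ.sub.get,
    hr φ φ.self_mem_sub, ?_, ?_, ?_⟩
  · intro i
    refine Fin.addCases (fun i χ hχ => ?_) (fun j χ hχ => ?_) i
    · rw [Fin.append_left, KForm.sub, List.mem_singleton] at hχ
      exact ⟨Fin.castAdd _ i, by rw [Fin.append_left, hχ]⟩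
    · rw [Fin.append_right] at hχ
      exact hr χ (KForm.sub_subset φ _ (List.get_mem _ _) hχ)
  · intro i
    refine Fin.addCases (fun i _ => ?_) (fun j hj => ?_) i
    · simp
    · simp at hj
  · rintro p ⟨i, hi⟩
    have hp : p < m := by
      revert hi
      refine Fin.addCases (fun i hi => ?_) (fun j hj => ?_) i
      · rw [Fin.append_left, KForm.atom.injEq] at hi
        exact hi ▸ i.2
      · rw [Fin.append_right] at hj
        exact hm p (hj ▸ List.get_mem _ _)
    exact ⟨Fin.castAdd _ ⟨p, hp⟩, hp, by rw [Fin.append_left]⟩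

/-- For every K^# formula φ there is a GNN A with ⟦φ⟧ = ⟦A⟧. -/
theorem from_logic_to_GNN (φ : KForm) :
    ∃ N : GNN, ∀ (G : PGraph) (u : G.V), φ.eval G u = true ↔ N.accepts G u := by
  obtain ⟨n, m, f, ⟨i₀, hi₀⟩, hsub, hatom, hbase⟩ := φ.exists_enumeration
  choose c a b H using fun j =>
    KForm.exists_trunc_preactivation_eq f {i | i < m} hbase (f j) (hsub j)
  let N : GNN :=
    { L := φ.size
      dim := fun _ => n
      C := fun _ i j => c j i
      A := fun _ i j => a j i
      b := fun _ j => b j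
      a := Pi.single i₀ 1 }
  have correct : ∀ (G : PGraph) (k : ℕ), CorrectUpTo f {i | i < m} k (N.state G k) := by
    intro G k
    induction k with
    | zero =>
      rintro v i (hi | hi)
      · rw [hatom i hi]
        simp only [GNN.state, KForm.indicator, KForm.eval]
        rfl
      · cases hf : f i <;> simp [hf, KForm.size] at hi
    | succ k ih =>
      intro v j hj
      refine H j k G (N.state G k) ih ?_ v
      rcases hj with hj | hj
      · rw [hatom j hj, KForm.size]
        omega
      · exact hj
  refine ⟨N, fun G u => ?_⟩
  have hout : ∑ i, (N.a i : ℝ) * N.state G N.L u i = φ.indicator G u := by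
    rw [← hi₀, ← correct G φ.size u i₀ (Or.inr (by rw [hi₀]))]
    change ∑ i : Fin n, ((Pi.single i₀ 1 : Fin n → ℤ) i : ℝ) * N.state G φ.size u i = _
    simp [Pi.single_apply]
  rw [GNN.accepts, hout, KForm.indicator]
  cases φ.eval G u <;> norm_num
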